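/- arXiv:1508.02694 — 9 statements merged into one kernel-verified Lean document; each statement's English description precedes it below -/
import Mathlib

section
/- A positive integer m is represented by the quadratic form x^2 + y^2 + 6z^2 (i.e., there exist integers x, y, z with x^2 + y^2 + 6z^2 = m) if and only if m is not of the form 9^k(9ℓ + 3) for some nonnegative integers k and ℓ. -/
/-- The form `a x² + b y² + c z² + 2 r y z + 2 s x z + 2 t x y`. -/
structure TernaryForm where
  (a b c r s t : ℤ)

namespace TernaryForm

def eval (f : TernaryForm) (x y z : ℤ) : ℤ :=
  f.a * x ^ 2 + f.b * y ^ 2 + f.c * z ^ 2 + 2 * f.r * y * z + 2 * f.s * x * z + 2 * f.t * x * y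

def det (f : TernaryForm) : ℤ :=
  f.a * f.b * f.c + 2 * f.r * f.s * f.t - f.a * f.r ^ 2 - f.b * f.s ^ 2 - f.c * f.t ^ 2

/-- The leading principal minor of order two. -/
def minor (f : TernaryForm) : ℤ := f.a * f.b - f.t ^ 2

/-- The form with the first two variables exchanged. -/
def swapXY (f : TernaryForm) : TernaryForm := ⟨f.b, f.a, f.c, f.s, f.r, f.t⟩

/-- The form with the last two variables exchanged. -/
def swapYZ (f : TernaryForm) : TernaryForm := ⟨f.a, f.c, f.b, f.r, f.t, f.s⟩

/-- The form obtained by replacing the second basis vector `e₂` by `e₂ + k e₁`. -/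
def shear (f : TernaryForm) (k : ℤ) : TernaryForm :=
  ⟨f.a, f.b + 2 * k * f.t + k ^ 2 * f.a, f.c, f.r + k * f.s, f.s, f.t + k * f.a⟩

/-- Positive definite forms of determinant `d` representing `m`, none of whose principal minors
of order two is `2` modulo `3`. -/
structure Admissible (d m : ℤ) (f : TernaryForm) : Prop where
  a_pos : 0 < f.a
  minor_pos : 0 < f.minor
  det_eq : f.det = d
  rep : ∃ x y z, f.eval x y z = m
  minor_xy : (f.a * f.b - f.t ^ 2) % 3 ≠ 2
  minor_xz : (f.a * f.c - f.s ^ 2) % 3 ≠ 2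
  minor_yz : (f.b * f.c - f.r ^ 2) % 3 ≠ 2

variable {d m : ℤ} {f : TernaryForm}

theorem Admissible.swapXY (h : f.Admissible d m) : f.swapXY.Admissible d m := by
  obtain ⟨ha, hB, hd, ⟨x, y, z, hr⟩, h1, h2, h3⟩ := h
  refine ⟨?_, ?_, ?_, ⟨y, x, z, ?_⟩, ?_, h3, h2⟩ <;>
    simp only [minor, det, eval, TernaryForm.swapXY] at *
  · nlinarith [sq_nonneg f.t]
  · linarith
  · linarith
  · linarith
  · rwa [mul_comm f.b]

theorem minor_mul_swapYZ_minor (f : TernaryForm) :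
    f.minor * f.swapYZ.minor = (f.a * f.r - f.s * f.t) ^ 2 + f.a * f.det := by
  simp only [minor, det, swapYZ]
  ring

theorem Admissible.swapYZ (hdpos : 0 < d) (h : f.Admissible d m) : f.swapYZ.Admissible d m := by
  have hC := f.minor_mul_swapYZ_minor
  obtain ⟨ha, hB, hd, ⟨x, y, z, hr⟩, h1, h2, h3⟩ := h
  refine ⟨ha, ?_, ?_, ⟨x, z, y, ?_⟩, h2, h1, ?_⟩
  · refine pos_of_mul_pos_right ?_ hB.le
    rw [hC, hd]
    positivity
  · simp only [det, TernaryForm.swapYZ] at *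
    linarith
  · simp only [eval, TernaryForm.swapYZ] at *
    linarith
  · simpa only [TernaryForm.swapYZ, mul_comm] using h3

theorem sq_mod_three {u v w k e : ℤ} (hu : u % 3 ≠ 2) (hw : w % 3 ≠ 2)
    (h : u * w - v ^ 2 = 3 * e) : (u + 2 * k * v + k ^ 2 * w) % 3 ≠ 2 := by
  have key : ∀ u v w k : ZMod 3, u ≠ 2 → w ≠ 2 → u * w - v ^ 2 = 0 →
      u + 2 * k * v + k ^ 2 * w ≠ 2 := by decide
  have cast_ne (n : ℤ) : n % 3 ≠ 2 ↔ (n : ZMod 3) ≠ 2 :=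
    not_congr (ZMod.intCast_eq_intCast_iff' n 2 3).symm
  rw [cast_ne] at *
  push_cast
  refine key _ _ _ _ hu hw ?_
  have := congrArg (Int.cast : ℤ → ZMod 3) h
  push_cast at this
  rw [this, show (3 : ZMod 3) = 0 from rfl, zero_mul]

theorem Admissible.shear (hd3 : 3 ∣ d) (h : f.Admissible d m) (k : ℤ) :
    (f.shear k).Admissible d m := by
  obtain ⟨ha, hB, hd, ⟨x, y, z, hr⟩, h1, h2, h3⟩ := h
  obtain ⟨e, rfl⟩ := hd3
  refine ⟨ha, ?_, ?_, ⟨x - k * y, y, z, ?_⟩, ?_, h2, ?_⟩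
  · simp only [minor, TernaryForm.shear] at *
    linarith
  · simp only [det, TernaryForm.shear] at *
    linarith
  · simp only [eval, TernaryForm.shear] at *
    linarith
  · convert h1 using 2
    simp only [TernaryForm.shear]
    ring
  · have := sq_mod_three (v := f.t * f.c - f.r * f.s) (k := k) h3 h2 (e := f.c * e) (by
      rw [mul_left_comm, ← hd, det]; ring)
    convert this using 2
    simp only [TernaryForm.shear]
    ring

theorem exists_abs_add_mul_le {a : ℤ} (ha : 0 < a) (t : ℤ) : ∃ k, |2 * (t + k * a)| ≤ a := by
  refine ⟨-((2 * t + a) / (2 * a)), ?_⟩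
  have h1 := Int.emod_add_mul_ediv (2 * t + a) (2 * a)
  have h2 := Int.emod_nonneg (2 * t + a) (by positivity : 2 * a ≠ 0)
  have h3 := Int.emod_lt_of_pos (2 * t + a) (by positivity : 0 < 2 * a)
  rw [abs_le]
  constructor <;> linarith

/-- Hermite reduction. -/
theorem Admissible.exists_reduced (hdpos : 0 < d) (hd3 : 3 ∣ d) (h : f.Admissible d m) :
    ∃ g : TernaryForm, g.Admissible d m ∧ g.a ≤ g.b ∧ |2 * g.t| ≤ g.a ∧ |2 * g.s| ≤ g.a ∧
      g.minor ≤ g.swapYZ.minor ∧ |2 * (g.a * g.r - g.s * g.t)| ≤ g.minor := by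
  obtain ⟨g, hg, hmin⟩ := (InvImage.wf (fun f : TernaryForm => (f.a.toNat, f.minor.toNat))
    (WellFounded.prod_lex wellFounded_lt wellFounded_lt)).has_min {f | f.Admissible d m} ⟨f, h⟩
  have hmin_a : ∀ g' : TernaryForm, g'.Admissible d m → g.a ≤ g'.a := by
    intro g' hg'
    by_contra! hlt
    refine hmin g' hg' (Prod.Lex.left _ _ ?_)
    have := hg'.a_pos
    show g'.a.toNat < g.a.toNat
    omega
  have hmin_minor : ∀ g' : TernaryForm, g'.Admissible d m → g'.a = g.a → g.minor ≤ g'.minor := by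
    intro g' hg' ha
    by_contra! hlt
    refine hmin g' hg' ?_
    simp only [InvImage, ha]
    refine Prod.Lex.right _ ?_
    have := hg'.minor_pos
    show g'.minor.toNat < g.minor.toNat
    omega
  -- shear the last variable along the second, then the last two along the first
  obtain ⟨k, hk⟩ := exists_abs_add_mul_le hg.minor_pos (g.a * g.r - g.s * g.t)
  let g₁ : TernaryForm := ⟨g.a, g.b, g.c + 2 * k * g.r + k ^ 2 * g.b, g.r + k * g.b,
    g.s + k * g.t, g.t⟩
  have hg₁ : g₁.Admissible d m := by
    convert (((hg.swapXY.swapYZ hdpos).shear hd3 k).swapYZ hdpos).swapXY using 1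
    simp only [TernaryForm.swapXY, TernaryForm.swapYZ, TernaryForm.shear, g₁]
  obtain ⟨l, hl⟩ := exists_abs_add_mul_le hg.a_pos g.t
  obtain ⟨n, hn⟩ := exists_abs_add_mul_le hg.a_pos (g.s + k * g.t)
  have hg₂ := (((hg₁.shear hd3 l).swapYZ hdpos).shear hd3 n).swapYZ hdpos
  refine ⟨_, hg₂, hmin_a _ hg₂.swapXY, hl, hn, ?_, ?_⟩
  · refine le_of_eq_of_le ?_ (hmin_minor _ (hg₂.swapYZ hdpos) rfl)
    simp only [minor, TernaryForm.shear, TernaryForm.swapYZ, g₁]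
    ring
  · convert hk using 1
    · congr 2
      simp only [minor, TernaryForm.shear, TernaryForm.swapYZ, g₁]
      ring
    · simp only [minor, TernaryForm.shear, TernaryForm.swapYZ, g₁]
      ring

theorem reduced_bounds {g : TernaryForm} (hg : g.Admissible d m) (hab : g.a ≤ g.b)
    (ht : |2 * g.t| ≤ g.a) (hBC : g.minor ≤ g.swapYZ.minor)
    (hR : |2 * (g.a * g.r - g.s * g.t)| ≤ g.minor) :
    3 * g.minor ^ 2 ≤ 4 * (g.a * d) ∧ 27 * g.a ^ 3 ≤ 64 * d := by
  have hC := g.minor_mul_swapYZ_minor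
  have ha := hg.a_pos
  have hB := hg.minor_pos
  rw [hg.det_eq] at hC
  have hR2 := sq_le_sq' (abs_le.1 hR).1 (abs_le.1 hR).2
  have ht2 := sq_le_sq' (abs_le.1 ht).1 (abs_le.1 ht).2
  have h1 : 3 * g.minor ^ 2 ≤ 4 * (g.a * d) := by nlinarith
  refine ⟨h1, ?_⟩
  have h2 : 3 * g.a ^ 2 ≤ 4 * g.minor := by
    simp only [minor]
    nlinarith
  have h3 : (3 * g.a ^ 2) ^ 2 ≤ (4 * g.minor) ^ 2 := by gcongr
  have h4 : g.a * (27 * g.a ^ 3) ≤ g.a * (64 * d) := by nlinarith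
  exact le_of_mul_le_mul_left h4 ha

/-- `x² + y² + 3z²` is the only reduced admissible form of determinant `3`. -/
theorem Admissible.exists_rep_three (h : f.Admissible 3 m) :
    ∃ x y z : ℤ, x ^ 2 + y ^ 2 + 3 * z ^ 2 = m := by
  obtain ⟨g, hg, hab, ht, hs, hBC, hR⟩ := h.exists_reduced (by norm_num) (by norm_num)
  obtain ⟨hB, ha⟩ := reduced_bounds hg hab ht hBC hR
  have hC := g.minor_mul_swapYZ_minor
  obtain ⟨ha0, hB0, hd, ⟨x, y, z, hr⟩, h1, -, -⟩ := hg
  rw [hd] at hC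
  obtain ⟨a, b, c, r, s, t⟩ := g
  simp only [minor, TernaryForm.swapYZ, eval, abs_le] at *
  have ha1 : a = 1 := by
    have : a < 2 := by by_contra! h2; nlinarith [pow_le_pow_left₀ (by norm_num) h2 3]
    omega
  subst ha1
  obtain rfl : t = 0 := by omega
  obtain rfl : s = 0 := by omega
  have hb : b < 3 := by by_contra! h2; nlinarith
  have hb0 : 0 < b := by omega
  interval_cases b
  · obtain rfl : r = 0 := by omega
    obtain rfl : c = 3 := by omega
    exact ⟨x, y, z, by linarith⟩
  · omega

/-- `x² + y² + 6z²` is the only reduced admissible form of determinant `6` with odd values. -/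
theorem Admissible.exists_rep_six (hm : m % 2 = 1) (h : f.Admissible 6 m) :
    ∃ x y z : ℤ, x ^ 2 + y ^ 2 + 6 * z ^ 2 = m := by
  obtain ⟨g, hg, hab, ht, hs, hBC, hR⟩ := h.exists_reduced (by norm_num) (by norm_num)
  obtain ⟨hB, ha⟩ := reduced_bounds hg hab ht hBC hR
  have hC := g.minor_mul_swapYZ_minor
  obtain ⟨ha0, hB0, hd, ⟨x, y, z, hr⟩, h1, -, -⟩ := hg
  rw [hd] at hC
  obtain ⟨a, b, c, r, s, t⟩ := g
  simp only [minor, TernaryForm.swapYZ, eval, abs_le] at *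
  have ha2 : a < 3 := by by_contra! h2; nlinarith [pow_le_pow_left₀ (by norm_num) h2 3]
  interval_cases a
  · obtain rfl : t = 0 := by omega
    obtain rfl : s = 0 := by omega
    have hb : b < 3 := by by_contra! h2; nlinarith
    interval_cases b
    · obtain rfl : r = 0 := by omega
      obtain rfl : c = 6 := by omega
      exact ⟨x, y, z, by linarith⟩
    · omega
  · exfalso
    have ht' : -1 ≤ t ∧ t ≤ 1 := by omega
    have hs' : -1 ≤ s ∧ s ≤ 1 := by omega
    have hB4 : 2 * b - t ^ 2 < 5 := by by_contra! h2; nlinarith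
    have hb : b = 2 := by nlinarith
    subst hb
    have hc : c % 2 = 0 := by
      obtain ⟨ht1, ht2⟩ := ht'
      obtain ⟨hs1, hs2⟩ := hs'
      interval_cases t <;> interval_cases s <;> (
        have hr1 : -2 ≤ r := by omega
        have hr2 : r ≤ 2 := by omega
        interval_cases r <;> omega)
    obtain ⟨c', rfl⟩ := Int.dvd_of_emod_eq_zero hc
    have : m = 2 * (x ^ 2 + y ^ 2 + c' * z ^ 2 + r * y * z + s * x * z + t * x * y) := by
      linarith
    omega

/-- The form with Gram matrix `!![a, w, t; w, q, 0; t, 0, n]`, where `q * a = w ^ 2 + b`. -/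
theorem exists_admissible {d n b q t w : ℤ} (hd3 : 3 ∣ d) (hb : 0 < b) (hb3 : b % 3 = 1)
    (hq : 0 < q) (hdet : n * b - t ^ 2 * q = d) (hw : q ∣ w ^ 2 + b) :
    ∃ f : TernaryForm, f.Admissible d n := by
  obtain ⟨a, ha⟩ := hw
  have ne_two {v x e : ℤ} (h : b * x = v ^ 2 + d * e) : x % 3 ≠ 2 := by
    obtain ⟨d', rfl⟩ := hd3
    have h3 : b * x % 3 = v ^ 2 % 3 := by
      rw [h, mul_assoc]
      omega
    intro hx
    rw [Int.mul_emod, hb3, hx] at h3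
    have : v % 3 = 0 ∨ v % 3 = 1 ∨ v % 3 = 2 := by omega
    rcases this with hv | hv | hv <;> simp [pow_two, Int.mul_emod, hv] at h3
  refine ⟨⟨a, q, n, 0, t, w⟩, ?_, ?_, ?_, ⟨0, 0, 1, ?_⟩, ?_, ?_, ?_⟩
  · refine pos_of_mul_pos_right ?_ hq.le
    show 0 < q * a
    rw [← ha]
    positivity
  · simp only [minor]
    linarith
  · simp only [det]
    linear_combination hdet - n * ha
  · simp only [eval]
    ring
  · have : a * q - w ^ 2 = b := by linarith
    simp only [this, hb3]
    norm_num
  · refine ne_two (v := t * w) (e := a) ?_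
    linear_combination -t ^ 2 * ha + a * hdet
  · refine ne_two (v := t * q) (e := q) ?_
    linear_combination q * hdet

end TernaryForm

open NumberTheorySymbols

/-- Dirichlet's theorem for the progression `(n * b - e) / k`, where `b ≡ β` modulo `24`. -/
theorem exists_prime_mul_eq {n k e g β c : ℤ} (hn : 0 < n) (hk : 0 < k) (hkg : k * g = 6)
    (heg : e ∣ g)
    (hβ : 0 ≤ β) (hβ' : β < 24) (hc : k * c = n * β - e) (hc2 : ¬ 2 ∣ c)
    (hc3 : ¬ (3 ∣ c ∧ 3 ∣ g * n)) :
    ∃ p b : ℕ, p.Prime ∧ p % 2 = 1 ∧ (b : ℤ) % 24 = β ∧ k * p = n * b - e := by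
  have hg : 0 < g := pos_of_mul_pos_right (by omega : 0 < k * g) hk.le
  have hN : 0 < 4 * (g * n) := by positivity
  have hcop : IsCoprime c (4 * (g * n)) := by
    have dvd_of_dvd {q l : ℤ} (hq : Prime q) (hl : Prime l) (h : q ∣ l) : l ∣ q :=
      (hq.associated_of_dvd hl h).symm.dvd
    refine isCoprime_of_prime_dvd (fun h => hN.ne' h.2) fun q hq hqc hqN => ?_
    have hq2 (h : q ∣ 2) : False := hc2 ((dvd_of_dvd hq Int.prime_two h).trans hqc)
    rcases hq.dvd_or_dvd hqN with h4 | hgn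
    · exact hq2 (hq.dvd_of_dvd_pow (n := 2) (by simpa using h4))
    · have hqg : q ∣ g := by
        refine (hq.dvd_or_dvd hgn).elim id fun hqn => Dvd.dvd.trans ?_ heg
        rw [show e = n * β - k * c by linarith]
        exact dvd_sub (hqn.mul_right _) (hqc.mul_left _)
      have hq6 : q ∣ 2 * 3 := (hqg.mul_left k).trans (by rw [hkg]; norm_num)
      refine (hq.dvd_or_dvd hq6).elim hq2 fun h => hc3 ?_
      have := dvd_of_dvd hq Int.prime_three h
      exact ⟨this.trans hqc, this.trans hgn⟩
  obtain ⟨p, hpc, hp, hmod⟩ := Nat.forall_exists_prime_gt_and_zmodEq c.natAbs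
    (q := (4 * (g * n)).toNat) (a := c) (by omega) (by rwa [Int.toNat_of_nonneg hN.le])
  rw [Int.toNat_of_nonneg hN.le] at hmod
  obtain ⟨j, hj⟩ := hmod.symm.dvd
  have hj0 : 0 < j := pos_of_mul_pos_right (by omega : 0 < 4 * (g * n) * j) hN.le
  have hp2 : p % 2 = 1 := by
    rw [mul_assoc] at hj
    omega
  refine ⟨p, (β + 24 * j).toNat, hp, hp2, ?_, ?_⟩ <;> rw [Int.toNat_of_nonneg (by omega)]
  · omega
  · linear_combination k * hj + hc + 4 * n * j * hkg

/-- If `k * p ≡ -e` modulo `b`, then `p` and `-k * e` have the same Jacobi symbol. -/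
theorem jacobiSym_neg_eq {p b : ℕ} {n k e : ℤ} (hcop : IsCoprime (k * e) b)
    (h : k * p = n * b - e) : J(-(k * e) | b) = J(p | b) := by
  rw [← one_mul J(p | b),
    ← jacobiSym.sq_one' (Int.isCoprime_iff_gcd_eq_one.1 hcop.of_mul_left_left), ← jacobiSym.mul_left]
  refine jacobiSym.mod_left' (Int.modEq_of_dvd ?_).symm
  exact ⟨-(k * n), by linear_combination -k * h⟩

theorem isSquare_neg_of_mod_eq_seven {p b : ℕ} {n k e : ℤ} (hp : p.Prime) (hp2 : p % 2 = 1)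
    (hb : (b : ℤ) % 24 = 7) (hke : k * e = 6) (h : k * p = n * b - e) :
    IsSquare ((-b : ℤ) : ZMod p) := by
  have := Fact.mk hp
  have hpo := Nat.odd_iff.2 hp2
  have hbo : Odd b := Nat.odd_iff.2 (by omega)
  refine ZMod.isSquare_of_jacobiSym_eq_one ?_
  have h1 : J(-b | p) = J(p | b) := by
    rw [jacobiSym.neg _ hpo]
    rcases Nat.odd_mod_four_iff.1 (Nat.odd_iff.1 hpo) with h4 | h4
    · rw [ZMod.χ₄_nat_one_mod_four h4, one_mul,
        jacobiSym.quadratic_reciprocity_one_mod_four' hbo h4]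
    · rw [ZMod.χ₄_nat_three_mod_four h4,
        jacobiSym.quadratic_reciprocity_three_mod_four (by omega) h4]
      ring
  have hcop : IsCoprime (6 : ℤ) b := by
    rw [show (6 : ℤ) = 2 * 3 by norm_num]
    refine IsCoprime.mul_left ?_ ?_
    · exact (Int.prime_two.coprime_iff_not_dvd).2 (by omega)
    · exact (Int.prime_three.coprime_iff_not_dvd).2 (by omega)
  have h2 : J(-6 | b) = J(p | b) := by
    rw [← hke]
    exact jacobiSym_neg_eq (hke ▸ hcop) h
  rw [h1, ← h2, jacobiSym.mod_right _ hbo, show b % (4 * Int.natAbs (-6)) = 7 by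
    norm_num; omega]
  norm_num

theorem isSquare_neg_of_mod_eq_ten {p b : ℕ} {n k e : ℤ} (hp : p.Prime) (hp8 : p % 8 = 7)
    (hb : (b : ℤ) % 24 = 10) (hke : k * e = 3) (h : k * p = n * b - e) :
    IsSquare ((-b : ℤ) : ZMod p) := by
  have := Fact.mk hp
  have hpo : Odd p := Nat.odd_iff.2 (by omega)
  obtain ⟨c, rfl⟩ : 2 ∣ b := by omega
  have hco : Odd c := Nat.odd_iff.2 (by omega)
  refine ZMod.isSquare_of_jacobiSym_eq_one ?_
  have h1 : J(-(2 * c : ℕ) | p) = -J(p | c) := by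
    rw [show (-(2 * c : ℕ) : ℤ) = -2 * (c : ℤ) by push_cast; ring, jacobiSym.mul_left,
      jacobiSym.at_neg_two hpo,
      jacobiSym.quadratic_reciprocity_one_mod_four (by omega) hpo, ZMod.χ₈'_nat_eq_if_mod_eight]
    simp [hp8, show p % 2 = 1 by omega]
  have h2 : J(-3 | c) = J(p | c) := by
    rw [← hke]
    refine jacobiSym_neg_eq (n := 2 * n) ?_ (by rw [h]; push_cast; ring)
    rw [hke]
    exact (Int.prime_three.coprime_iff_not_dvd).2 (by omega)
  rw [h1, ← h2, jacobiSym.mod_right _ hco, show c % (4 * Int.natAbs (-3)) = 5 by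
    norm_num; omega]
  norm_num

theorem exists_dvd_sq_add {p : ℕ} {b : ℤ} (h : IsSquare ((-b : ℤ) : ZMod p)) :
    ∃ w : ℤ, (p : ℤ) ∣ w ^ 2 + b := by
  obtain ⟨w, hw⟩ := h
  obtain ⟨w, rfl⟩ := ZMod.intCast_surjective w
  refine ⟨w, (ZMod.intCast_zmod_eq_zero_iff_dvd _ p).1 ?_⟩
  push_cast at hw ⊢
  linear_combination -hw

theorem exists_two_mul_dvd_sq_add {p b : ℤ} (hp : p % 2 = 1) (hb : b % 2 = 1)
    (h : ∃ w : ℤ, p ∣ w ^ 2 + b) : ∃ w : ℤ, 2 * p ∣ w ^ 2 + b := by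
  obtain ⟨w, hw⟩ := h
  obtain ⟨w', hw', h2⟩ : ∃ w', p ∣ w' ^ 2 + b ∧ w' % 2 = 1 := by
    rcases Int.emod_two_eq_zero_or_one w with h0 | h1
    · refine ⟨w + p, ?_, by omega⟩
      rw [show (w + p) ^ 2 + b = w ^ 2 + b + p * (2 * w + p) by ring]
      exact dvd_add hw (dvd_mul_right _ _)
    · exact ⟨w, hw, h1⟩
  refine ⟨w', IsCoprime.mul_dvd ?_ ?_ hw'⟩
  · exact Int.isCoprime_two_left.2 (Int.odd_iff.2 hp)
  · refine Int.dvd_of_emod_eq_zero ?_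
    rw [Int.add_emod, pow_two, Int.mul_emod, h2, hb]
    norm_num

theorem exists_rep_odd {m : ℤ} (hm : 0 < m) (h2 : m % 2 = 1) (h9 : m % 9 ≠ 0)
    (h3 : m % 9 ≠ 3) : ∃ x y z : ℤ, x ^ 2 + y ^ 2 + 6 * z ^ 2 = m := by
  by_cases hm3 : m % 3 = 0
  · obtain ⟨n, rfl⟩ := Int.dvd_of_emod_eq_zero hm3
    obtain ⟨p, b, hp, hp2, hb, h⟩ := exists_prime_mul_eq (n := n) (k := 3) (e := 2) (g := 2)
          (β := 7)
      (c := (n * 7 - 2) / 3) (by omega) (by norm_num) (by norm_num) (by norm_num) (by norm_num)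
      (by norm_num) (by omega) (by omega) (by omega)
    obtain ⟨w, hw⟩ := exists_dvd_sq_add (isSquare_neg_of_mod_eq_seven hp hp2 hb (by norm_num) h)
    obtain ⟨f, hf⟩ := TernaryForm.exists_admissible (d := 6) (n := 3 * n) (t := 3) (by norm_num)
      (by omega) (by omega) (mod_cast hp.pos) (by linarith) hw
    exact hf.exists_rep_six h2
  · obtain ⟨p, b, hp, hp2, hb, h⟩ := exists_prime_mul_eq (n := m) (k := 1) (e := 6) (g := 6)
        (β := 7)
      (c := m * 7 - 6) (by omega) (by norm_num) (by norm_num) (by norm_num) (by norm_num)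
      (by norm_num) (by omega) (by omega) (by omega)
    obtain ⟨w, hw⟩ := exists_dvd_sq_add (isSquare_neg_of_mod_eq_seven hp hp2 hb (by norm_num) h)
    obtain ⟨f, hf⟩ := TernaryForm.exists_admissible (d := 6) (n := m) (t := 1) (by norm_num)
      (by omega) (by omega) (mod_cast hp.pos) (by linarith) hw
    exact hf.exists_rep_six h2

theorem exists_rep_three_odd {m : ℤ} (hm : 0 < m) (h2 : m % 2 = 1) (h9 : m % 9 ≠ 0)
    (h6 : m % 9 ≠ 6) : ∃ x y z : ℤ, x ^ 2 + y ^ 2 + 3 * z ^ 2 = m := by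
  have emod_eight {p b : ℕ} {n k e : ℤ} (h : k * p = n * b - e) (hb : (b : ℤ) % 24 = 10) :
      (k * p + e) % 8 = 2 * n % 8 := by
    obtain ⟨u, hu⟩ : ∃ u, n * b = 8 * u + 2 * n :=
      ⟨n * (b / 8), by linear_combination n * (by omega : (b : ℤ) = 8 * (b / 8) + 2)⟩
    omega
  by_cases hm3 : m % 3 = 0
  · obtain ⟨n, rfl⟩ := Int.dvd_of_emod_eq_zero hm3
    rcases (by omega : n % 4 = 1 ∨ n % 4 = 3) with h4 | h4
    · obtain ⟨p, b, hp, hp2, hb, h⟩ := exists_prime_mul_eq (n := n) (k := 6) (e := 1) (g := 1)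
          (β := 7)
        (c := (n * 7 - 1) / 6) (by omega) (by norm_num) (by norm_num) (by norm_num)
        (by norm_num) (by norm_num) (by omega) (by omega) (by omega)
      obtain ⟨w, hw⟩ := exists_two_mul_dvd_sq_add (by omega) (by omega)
        (exists_dvd_sq_add (isSquare_neg_of_mod_eq_seven hp hp2 hb (by norm_num) h))
      obtain ⟨f, hf⟩ := TernaryForm.exists_admissible (d := 3) (n := 3 * n) (t := 3)
        (by norm_num) (by omega) (by omega) (by have := hp.pos; omega) (by linarith) hw
      exact hf.exists_rep_three
    · obtain ⟨p, b, hp, hp2, hb, h⟩ := exists_prime_mul_eq (n := n) (k := 3) (e := 1) (g := 2)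
          (β := 10)
        (c := (n * 10 - 1) / 3) (by omega) (by norm_num) (by norm_num) (by norm_num)
        (by norm_num) (by norm_num) (by omega) (by omega) (by omega)
      have h8 := emod_eight h hb
      obtain ⟨w, hw⟩ := exists_dvd_sq_add
        (isSquare_neg_of_mod_eq_ten hp (by omega) hb (by norm_num) h)
      obtain ⟨f, hf⟩ := TernaryForm.exists_admissible (d := 3) (n := 3 * n) (t := 3)
        (by norm_num) (by omega) (by omega) (mod_cast hp.pos) (by linarith) hw
      exact hf.exists_rep_three
  · rcases (by omega : m % 4 = 1 ∨ m % 4 = 3) with h4 | h4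
    · obtain ⟨p, b, hp, hp2, hb, h⟩ := exists_prime_mul_eq (n := m) (k := 1) (e := 3) (g := 6)
          (β := 10)
        (c := m * 10 - 3) (by omega) (by norm_num) (by norm_num) (by norm_num)
        (by norm_num) (by norm_num) (by omega) (by omega) (by omega)
      have h8 := emod_eight h hb
      obtain ⟨w, hw⟩ := exists_dvd_sq_add
        (isSquare_neg_of_mod_eq_ten hp (by omega) hb (by norm_num) h)
      obtain ⟨f, hf⟩ := TernaryForm.exists_admissible (d := 3) (n := m) (t := 1)
        (by norm_num) (by omega) (by omega) (mod_cast hp.pos) (by linarith) hw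
      exact hf.exists_rep_three
    · obtain ⟨p, b, hp, hp2, hb, h⟩ := exists_prime_mul_eq (n := m) (k := 2) (e := 3) (g := 3)
          (β := 7)
        (c := (m * 7 - 3) / 2) (by omega) (by norm_num) (by norm_num) (by norm_num)
        (by norm_num) (by norm_num) (by omega) (by omega) (by omega)
      obtain ⟨w, hw⟩ := exists_two_mul_dvd_sq_add (by omega) (by omega)
        (exists_dvd_sq_add (isSquare_neg_of_mod_eq_seven hp hp2 hb (by norm_num) h))
      obtain ⟨f, hf⟩ := TernaryForm.exists_admissible (d := 3) (n := m) (t := 1)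
        (by norm_num) (by omega) (by omega) (by have := hp.pos; omega) (by linarith) hw
      exact hf.exists_rep_three

theorem exists_rep_of_ne (m : ℕ) (hm : 0 < m) (h : ∀ k l : ℕ, m ≠ 9 ^ k * (9 * l + 3)) :
    ∃ x y z : ℤ, x ^ 2 + y ^ 2 + 6 * z ^ 2 = m := by
  induction m using Nat.strong_induction_on with
  | _ m ih =>
    have h3 : m % 9 ≠ 3 := fun h3 => h 0 (m / 9) (by omega)
    by_cases h9 : m % 9 = 0
    · obtain ⟨n, rfl⟩ := Nat.dvd_of_mod_eq_zero h9
      obtain ⟨x, y, z, hr⟩ := ih n (by omega) (by omega) fun k l hkl =>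
        h (k + 1) l (by rw [hkl]; ring)
      refine ⟨3 * x, 3 * y, 3 * z, ?_⟩
      push_cast
      linarith
    by_cases h4 : m % 4 = 0
    · obtain ⟨n, rfl⟩ := Nat.dvd_of_mod_eq_zero h4
      obtain ⟨x, y, z, hr⟩ := ih n (by omega) (by omega) fun k l hkl =>
        h k (4 * l + 1) (by rw [hkl]; ring)
      refine ⟨2 * x, 2 * y, 2 * z, ?_⟩
      push_cast
      linarith
    by_cases h2 : m % 2 = 0
    · obtain ⟨n, rfl⟩ := Nat.dvd_of_mod_eq_zero h2
      obtain ⟨x, y, z, hr⟩ := exists_rep_three_odd (m := n) (by omega) (by omega) (by omega)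
        (by omega)
      refine ⟨x + y, x - y, z, ?_⟩
      push_cast
      linarith
    · exact exists_rep_odd (by omega) (by omega) (by omega) (by omega)

theorem three_dvd_of_sq_add_sq {x y : ℤ} (h : 3 ∣ x ^ 2 + y ^ 2) : 3 ∣ x ∧ 3 ∣ y := by
  have key : ∀ x y : ZMod 3, x ^ 2 + y ^ 2 = 0 → x = 0 ∧ y = 0 := by decide
  have cast_dvd (a : ℤ) : 3 ∣ a ↔ (a : ZMod 3) = 0 := (ZMod.intCast_zmod_eq_zero_iff_dvd a 3).symm
  simp only [cast_dvd] at *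
  exact key _ _ (mod_cast h)

theorem rep_ne (k l : ℕ) (x y z : ℤ) : x ^ 2 + y ^ 2 + 6 * z ^ 2 ≠ 9 ^ k * (9 * l + 3) := by
  have sq_mod (z : ℤ) : z ^ 2 % 3 ≠ 2 := by
    have : z % 3 = 0 ∨ z % 3 = 1 ∨ z % 3 = 2 := by omega
    rcases this with hz | hz | hz <;> simp [pow_two, Int.mul_emod, hz]
  induction k generalizing x y z with
  | zero =>
    intro h
    rw [pow_zero, one_mul] at h
    obtain ⟨⟨u, rfl⟩, ⟨v, rfl⟩⟩ := three_dvd_of_sq_add_sq (x := x) (y := y) (by omega)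
    rw [mul_pow, mul_pow] at h
    have := sq_mod z
    omega
  | succ k ih =>
    intro h
    rw [pow_succ' 9, mul_assoc 9] at h
    obtain ⟨⟨u, rfl⟩, ⟨v, rfl⟩⟩ := three_dvd_of_sq_add_sq (x := x) (y := y) (by omega)
    obtain ⟨w, rfl⟩ : 3 ∣ z := Int.prime_three.dvd_of_dvd_pow (n := 2) (by
      rw [mul_pow, mul_pow] at h
      omega)
    exact ih u v w (by linarith)

theorem rep_x2_y2_6z2 (m : ℤ) (hm : 0 < m) :
    (∃ x y z : ℤ, x ^ 2 + y ^ 2 + 6 * z ^ 2 = m) ↔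
      ¬ ∃ k l : ℕ, m = 9 ^ k * (9 * l + 3) := by
  constructor
  · rintro ⟨x, y, z, h⟩ ⟨k, l, hkl⟩
    exact rep_ne k l x y z (h.trans hkl)
  · intro h
    lift m to ℕ using hm.le
    exact exists_rep_of_ne m (mod_cast hm) fun k l hkl => h ⟨k, l, mod_cast hkl⟩
end

section
/- Let m be an even positive integer. Then m is not represented by the quadratic form x^2 + y^2 + 2z^2 if and only if 4m is not represented by x^2 + y^2 + 2z^2. -/
/-- If `8` divides `x ^ 2 + y ^ 2 + 2 * z ^ 2`, then `x`, `y` and `z` are all even. -/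
theorem even_of_eight_dvd_sq_add_sq_add_two_mul_sq {x y z : ℤ}
    (h : 8 ∣ x ^ 2 + y ^ 2 + 2 * z ^ 2) : Even x ∧ Even y ∧ Even z := by
  have sq_form (t : ℤ) : (Even t ∧ ∃ k, t ^ 2 = 4 * k) ∨ ∃ k, t ^ 2 = 8 * k + 1 := by
    rcases Int.even_or_odd t with ht | ht
    · obtain ⟨a, rfl⟩ := ht
      exact Or.inl ⟨⟨a, rfl⟩, a ^ 2, by ring⟩
    · obtain ⟨k, hk⟩ := Int.eight_dvd_sq_sub_one_of_odd ht
      exact Or.inr ⟨k, by linarith⟩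
  rcases sq_form x with ⟨hx, a, ha⟩ | ⟨a, ha⟩ <;>
  rcases sq_form y with ⟨hy, b, hb⟩ | ⟨b, hb⟩ <;>
  rcases sq_form z with ⟨hz, c, hc⟩ | ⟨c, hc⟩ <;>
  first
  | exact ⟨hx, hy, hz⟩
  | omega

theorem not_rep_iff_four_mul (m : ℤ) (hm : 0 < m) (hme : Even m) :
    (¬ ∃ x y z : ℤ, x ^ 2 + y ^ 2 + 2 * z ^ 2 = m) ↔
      ¬ ∃ x y z : ℤ, x ^ 2 + y ^ 2 + 2 * z ^ 2 = 4 * m := by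
  refine not_congr ⟨?_, ?_⟩
  · rintro ⟨x, y, z, h⟩
    exact ⟨2 * x, 2 * y, 2 * z, by linear_combination 4 * h⟩
  · rintro ⟨x, y, z, h⟩
    obtain ⟨k, rfl⟩ := hme
    obtain ⟨⟨a, rfl⟩, ⟨b, rfl⟩, ⟨c, rfl⟩⟩ :=
      even_of_eight_dvd_sq_add_sq_add_two_mul_sq ⟨k, by rw [h]; ring⟩
    exact ⟨a, b, c, by linarith⟩
end

section
/- Let m be a positive integer. If m is not represented by the quadratic form x^2 + 2y^2 + 2yz + 2z^2, then 4m is not represented by x^2 + 2y^2 + 2yz + 2z^2. -/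
/-- The form `y ^ 2 + y * z + z ^ 2` is anisotropic modulo `2`. -/
theorem Int.even_and_even_of_even_sq_add_mul_add_sq {y z : ℤ}
    (h : Even (y ^ 2 + y * z + z ^ 2)) : Even y ∧ Even z := by
  simp only [Int.even_add, Int.even_mul, Int.even_pow] at h
  tauto

theorem not_rep_four_mul_Q2 (m : ℤ) (hm : 0 < m)
    (h : ¬ ∃ x y z : ℤ, x ^ 2 + 2 * y ^ 2 + 2 * y * z + 2 * z ^ 2 = m) :
    ¬ ∃ x y z : ℤ, x ^ 2 + 2 * y ^ 2 + 2 * y * z + 2 * z ^ 2 = 4 * m := by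
  rintro ⟨x, y, z, hxyz⟩
  have hx : Even x := by
    have hsq : Even (x ^ 2) := ⟨2 * m - (y ^ 2 + y * z + z ^ 2), by linarith⟩
    exact (Int.even_pow.mp hsq).1
  obtain ⟨a, rfl⟩ := hx
  have hyz : Even (y ^ 2 + y * z + z ^ 2) := ⟨m - a ^ 2, by linarith⟩
  obtain ⟨⟨b, rfl⟩, ⟨c, rfl⟩⟩ := Int.even_and_even_of_even_sq_add_mul_add_sq hyz
  exact h ⟨a, b, c, by linarith⟩
end

section
/- Let m be a positive integer. If m is not represented by the quadratic form x^2 + 2y^2 + 2z^2, then 4m is not represented by x^2 + 2y^2 + 2z^2. -/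
/-- A sum of three squares in which two of the terms have the same parity is represented by
`x ^ 2 + 2 * y ^ 2 + 2 * z ^ 2`. -/
lemma exists_rep_of_even_add {a b : ℤ} (c : ℤ) (hab : Even (a + b)) :
    ∃ x y z : ℤ, x ^ 2 + 2 * y ^ 2 + 2 * z ^ 2 = a ^ 2 + b ^ 2 + c ^ 2 := by
  obtain ⟨k, hk⟩ := hab
  obtain rfl : b = k + k - a := by linarith
  exact ⟨c, k, k - a, by ring⟩

/-- Every sum of three squares is represented by `x ^ 2 + 2 * y ^ 2 + 2 * z ^ 2`. -/
lemma exists_rep_of_sum_three_squares (a b c : ℤ) :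
    ∃ x y z : ℤ, x ^ 2 + 2 * y ^ 2 + 2 * z ^ 2 = a ^ 2 + b ^ 2 + c ^ 2 := by
  have parity : Even (a + b) ∨ Even (b + c) ∨ Even (c + a) := by
    simp only [Int.even_add]
    tauto
  rcases parity with h | h | h
  · exact exists_rep_of_even_add c h
  · obtain ⟨x, y, z, e⟩ := exists_rep_of_even_add a h
    exact ⟨x, y, z, by linarith⟩
  · obtain ⟨x, y, z, e⟩ := exists_rep_of_even_add b h
    exact ⟨x, y, z, by linarith⟩

theorem not_rep_four_mul_x2_2y2_2z2 (m : ℤ) (hm : 0 < m)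
    (h : ¬ ∃ x y z : ℤ, x ^ 2 + 2 * y ^ 2 + 2 * z ^ 2 = m) :
    ¬ ∃ x y z : ℤ, x ^ 2 + 2 * y ^ 2 + 2 * z ^ 2 = 4 * m := by
  rintro ⟨x, y, z, e⟩
  apply h
  have hx : Even x := by
    have : Even (x ^ 2) := ⟨2 * m - y ^ 2 - z ^ 2, by linarith⟩
    exact (Int.even_pow.mp this).1
  obtain ⟨u, rfl⟩ := hx
  have hyz : Even (y + z) := by
    have : Even (y ^ 2 + z ^ 2) := ⟨m - u ^ 2, by linarith⟩
    simpa [Int.even_add, Int.even_pow] using this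
  obtain ⟨k, hk⟩ := hyz
  obtain rfl : z = k + k - y := by linarith
  have hsum : u ^ 2 + k ^ 2 + (k - y) ^ 2 = m := by linarith
  exact hsum ▸ exists_rep_of_sum_three_squares u k (k - y)
end

section
/- Let m be a positive integer. If m is not represented by the quadratic form x^2 + y^2 + 6z^2, then 9m is not represented by x^2 + y^2 + 6z^2. -/
/-- A sum of two integer squares is divisible by `3` only if both terms are. -/
lemma three_dvd_of_three_dvd_sq_add_sq {x y : ℤ} (h : (3 : ℤ) ∣ x ^ 2 + y ^ 2) :
    (3 : ℤ) ∣ x ∧ (3 : ℤ) ∣ y := by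
  simp only [← Nat.cast_ofNat (R := ℤ) (n := 3), ← ZMod.intCast_zmod_eq_zero_iff_dvd] at h ⊢
  push_cast at h
  generalize (x : ZMod 3) = a at h ⊢
  generalize (y : ZMod 3) = b at h ⊢
  revert a b
  decide

theorem not_rep_nine_mul_x2_y2_6z2 (m : ℤ) (hm : 0 < m)
    (h : ¬ ∃ x y z : ℤ, x ^ 2 + y ^ 2 + 6 * z ^ 2 = m) :
    ¬ ∃ x y z : ℤ, x ^ 2 + y ^ 2 + 6 * z ^ 2 = 9 * m := by
  rintro ⟨x, y, z, hxyz⟩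
  obtain ⟨⟨a, rfl⟩, ⟨b, rfl⟩⟩ : (3 : ℤ) ∣ x ∧ (3 : ℤ) ∣ y :=
    three_dvd_of_three_dvd_sq_add_sq ⟨3 * m - 2 * z ^ 2, by linarith⟩
  obtain ⟨c, rfl⟩ : (3 : ℤ) ∣ z :=
    Int.prime_three.dvd_of_dvd_pow (n := 2) (by ring_nf at hxyz; omega)
  exact h ⟨a, b, c, by linarith⟩
end

section
/- Let m be an even positive integer. If m is not represented by the quadratic form x^2 + 2y^2 + 3z^2, then 4m is not represented by x^2 + 2y^2 + 3z^2. -/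
theorem not_rep_four_mul_x2_2y2_3z2 (m : ℤ) (hm : 0 < m) (hme : Even m)
    (h : ¬ ∃ x y z : ℤ, x ^ 2 + 2 * y ^ 2 + 3 * z ^ 2 = m) :
    ¬ ∃ x y z : ℤ, x ^ 2 + 2 * y ^ 2 + 3 * z ^ 2 = 4 * m := by
  rintro ⟨x, y, z, hxyz⟩
  obtain ⟨k, rfl⟩ := hme
  rcases Int.even_or_odd x with hx | hx <;> rcases Int.even_or_odd z with hz | hz
  · obtain ⟨a, rfl⟩ := hx
    obtain ⟨c, rfl⟩ := hz
    rcases Int.even_or_odd y with ⟨b, rfl⟩ | ⟨b, rfl⟩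
    · exact h ⟨a, b, c, by linarith⟩
    · ring_nf at hxyz
      omega
  · obtain ⟨a, rfl⟩ := hx
    obtain ⟨c, rfl⟩ := hz
    ring_nf at hxyz
    omega
  · obtain ⟨a, rfl⟩ := hx
    obtain ⟨c, rfl⟩ := hz
    ring_nf at hxyz
    omega
  · have hx' := Int.eight_dvd_sq_sub_one_of_odd hx
    have hz' := Int.eight_dvd_sq_sub_one_of_odd hz
    rcases Int.even_or_odd y with ⟨b, rfl⟩ | ⟨b, rfl⟩
    · ring_nf at hxyz
      omega
    · ring_nf at hxyz
      omega
end

section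
/- Let m be a positive integer. Then 25m is represented by the quadratic form x^2 + 2y^2 + 5z^2 if and only if m is represented by x^2 + 2y^2 + 5z^2. -/
/-- The form `x ^ 2 + 2 * y ^ 2` is anisotropic modulo `5`. -/
theorem five_dvd_and_five_dvd_of_dvd_sq_add_two_mul_sq {x y : ℤ} (h : 5 ∣ x ^ 2 + 2 * y ^ 2) :
    5 ∣ x ∧ 5 ∣ y := by
  have key : ∀ a b : ZMod 5, a ^ 2 + 2 * b ^ 2 = 0 → a = 0 ∧ b = 0 := by decide
  have h' := (ZMod.intCast_zmod_eq_zero_iff_dvd (x ^ 2 + 2 * y ^ 2) 5).2 h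
  push_cast at h'
  obtain ⟨hx, hy⟩ := key _ _ h'
  exact ⟨(ZMod.intCast_zmod_eq_zero_iff_dvd x 5).1 hx, (ZMod.intCast_zmod_eq_zero_iff_dvd y 5).1 hy⟩

theorem rep_25_mul_x2_2y2_5z2 (m : ℤ) (hm : 0 < m) :
    (∃ x y z : ℤ, x ^ 2 + 2 * y ^ 2 + 5 * z ^ 2 = 25 * m) ↔
      ∃ x y z : ℤ, x ^ 2 + 2 * y ^ 2 + 5 * z ^ 2 = m := by
  constructor
  · rintro ⟨x, y, z, h⟩
    obtain ⟨⟨a, rfl⟩, b, rfl⟩ := five_dvd_and_five_dvd_of_dvd_sq_add_two_mul_sq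
      (x := x) (y := y) ⟨5 * m - z ^ 2, by linarith⟩
    have hz : (5 : ℤ) ∣ z ^ 2 := ⟨m - a ^ 2 - 2 * b ^ 2, by linarith⟩
    obtain ⟨c, rfl⟩ :=
      (Nat.prime_iff_prime_int.1 Nat.prime_five).dvd_of_dvd_pow hz
    push_cast at h
    exact ⟨a, b, c, by linarith⟩
  · rintro ⟨x, y, z, rfl⟩
    exact ⟨5 * x, 5 * y, 5 * z, by ring⟩
end

section
/- Let m be a positive integer. If 4m is represented by the quadratic form x^2 + y^2 + 5z^2, then m is represented by x^2 + y^2 + 5z^2. -/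
theorem rep_four_mul_x2_y2_5z2 (m : ℤ) (hm : 0 < m)
    (h : ∃ x y z : ℤ, x ^ 2 + y ^ 2 + 5 * z ^ 2 = 4 * m) :
    ∃ x y z : ℤ, x ^ 2 + y ^ 2 + 5 * z ^ 2 = m := by
  obtain ⟨x, y, z, h⟩ := h
  obtain ⟨a, rfl | rfl⟩ := Int.even_or_odd' x <;>
  obtain ⟨b, rfl | rfl⟩ := Int.even_or_odd' y <;>
  obtain ⟨c, rfl | rfl⟩ := Int.even_or_odd' z <;>
  ring_nf at h
  · exact ⟨a, b, c, by linarith⟩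
  all_goals omega
end

section
/- Let m be a positive integer. If 25m is represented by the quadratic form x^2 + 2y^2 + 2yz + 3z^2, then m is represented by x^2 + 2y^2 + 2yz + 3z^2. -/
/-- The form `x ^ 2 - 2 * w ^ 2` is anisotropic modulo `5`. -/
lemma five_dvd_of_five_dvd_sq_sub_two_mul_sq {x w : ℤ} (h : (5 : ℤ) ∣ x ^ 2 - 2 * w ^ 2) :
    (5 : ℤ) ∣ x ∧ (5 : ℤ) ∣ w := by
  have anisotropic : ∀ a b : ZMod 5, a ^ 2 - 2 * b ^ 2 = 0 → a = 0 ∧ b = 0 := by decide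
  have h0 := (ZMod.intCast_zmod_eq_zero_iff_dvd _ 5).2 h
  push_cast at h0
  obtain ⟨hx, hw⟩ := anisotropic _ _ h0
  exact ⟨(ZMod.intCast_zmod_eq_zero_iff_dvd x 5).1 hx,
    (ZMod.intCast_zmod_eq_zero_iff_dvd w 5).1 hw⟩

theorem rep_25_mul_x2_2y2_2yz_3z2 (m : ℤ) (hm : 0 < m)
    (h : ∃ x y z : ℤ, x ^ 2 + 2 * y ^ 2 + 2 * y * z + 3 * z ^ 2 = 25 * m) :
    ∃ x y z : ℤ, x ^ 2 + 2 * y ^ 2 + 2 * y * z + 3 * z ^ 2 = m := by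
  obtain ⟨x, y, z, h⟩ := h
  obtain ⟨⟨a, rfl⟩, b, hb⟩ := five_dvd_of_five_dvd_sq_sub_two_mul_sq (x := x) (w := 2 * y + z)
    ⟨5 * m - 2 * y ^ 2 - 2 * y * z - z ^ 2, by linear_combination h⟩
  obtain rfl : z = 5 * b - 2 * y := by linear_combination hb
  have hy : (5 : ℤ) ∣ y := by
    have hsq : (5 : ℤ) ∣ 2 * y ^ 2 :=
      ⟨m - a ^ 2 - 3 * b ^ 2 + 2 * b * y, by linarith⟩
    have h2 : IsCoprime (5 : ℤ) 2 := by norm_num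
    exact Int.Prime.dvd_pow' Nat.prime_five (h2.dvd_of_dvd_mul_left hsq)
  obtain ⟨c, rfl⟩ := hy
  exact ⟨a, c, b - 2 * c, by linarith⟩
end
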